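/- arXiv:2008.11292 — 5 statements merged into one kernel-verified Lean document; each statement's English description precedes it below -/
import Mathlib

section
/- Let u, v ∈ ℤ² be primitive vectors with nonnegative coordinates such that |det(u,v)| = 1 and Q(u) > Q(v). Then: (i) u − v has nonnegative coordinates and is primitive; (ii) Q(u−v) < Q(u); (iii) Q(u+v) > Q(u−v). Hence the parallelogram with sides u and v and vertices 0, u, v, u+v has u+v as its longer diagonal and u−v as its shorter diagonal, and the shorter diagonal u−v together with v form the boundary edges of the Farey parallelogram of the longer boundary edge u. -/
/-- The triangular-lattice quadratic form: the squared length of the lattice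
vector `x·u₁ + y·u₂` for unit vectors `u₁, u₂` at angle 60°. -/
def Qval (p : ℤ × ℤ) : ℤ := p.1 ^ 2 + p.1 * p.2 + p.2 ^ 2

/-- Determinant of the pair of lattice vectors `u, v`. -/
def det2 (u v : ℤ × ℤ) : ℤ := u.1 * v.2 - v.1 * u.2

/-- A lattice vector is primitive if its coordinates are coprime. -/
def Primitive (p : ℤ × ℤ) : Prop := Int.gcd p.1 p.2 = 1

/-- If the first coordinate decreases and the second increases between two nonnegative vectors
of determinant one, then they are the standard basis vectors. -/
lemma eq_standard_basis_of_det_eq_one {a b c d : ℤ} (ha : 0 ≤ a) (hd : 0 ≤ d)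
    (hac : a < c) (hdb : d < b) (h : b * c - a * d = 1) :
    a = 0 ∧ b = 1 ∧ c = 1 ∧ d = 0 := by
  have key : (d + 1) * (a + 1) ≤ b * c :=
    mul_le_mul (by omega) (by omega) (by omega) (by omega)
  have ha' : a = 0 := by linarith
  have hd' : d = 0 := by linarith
  subst ha' hd'
  have hbc : b * c = 1 := by linarith
  exact ⟨rfl, Int.eq_one_of_mul_eq_one_right (by omega) hbc,
    Int.eq_one_of_mul_eq_one_left (by omega) hbc, rfl⟩

/-- Among two nonnegative vectors of determinant `±1`, the one on which the triangular-lattice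
form is larger has the first coordinate at least as large. -/
lemma le_fst_of_form_lt {a b c d : ℤ} (ha : 0 ≤ a) (hb : 0 ≤ b) (hd : 0 ≤ d)
    (hdet : a * d - c * b = 1 ∨ a * d - c * b = -1)
    (hQ : c ^ 2 + c * d + d ^ 2 < a ^ 2 + a * b + b ^ 2) : c ≤ a := by
  by_contra! hac
  rcases lt_or_ge d b with hdb | hbd
  · have h : b * c - a * d = 1 := by
      have : (d + 1) * (a + 1) ≤ b * c :=
        mul_le_mul (by omega) (by omega) (by omega) (by omega)
      rcases hdet with h | h <;> nlinarith
    obtain ⟨rfl, rfl, rfl, rfl⟩ := eq_standard_basis_of_det_eq_one ha hd hac hdb h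
    norm_num at hQ
  · have h₁ : a ^ 2 ≤ c ^ 2 := pow_le_pow_left₀ ha hac.le 2
    have h₂ : b ^ 2 ≤ d ^ 2 := pow_le_pow_left₀ hb hbd 2
    have h₃ : a * b ≤ c * d := mul_le_mul hac.le hbd hb (by omega)
    linarith

/-- If `u, v` are primitive lattice vectors with nonnegative coordinates,
`|det(u,v)| = 1` and `Q(u) > Q(v)`, then `u − v` has nonnegative coordinates
and is primitive, `Q(u−v) < Q(u)`, and `Q(u+v) > Q(u−v)`. -/
theorem stmt3 (u v : ℤ × ℤ) (hu : Primitive u) (hv : Primitive v)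
    (hu0 : 0 ≤ u.1 ∧ 0 ≤ u.2) (hv0 : 0 ≤ v.1 ∧ 0 ≤ v.2)
    (hdet : |det2 u v| = 1) (hQ : Qval v < Qval u) :
    (0 ≤ (u - v).1 ∧ 0 ≤ (u - v).2) ∧ Primitive (u - v) ∧
    Qval (u - v) < Qval u ∧ Qval (u - v) < Qval (u + v) := by
  obtain ⟨a, b⟩ := u
  obtain ⟨c, d⟩ := v
  simp only [Qval, det2, Primitive, Prod.mk_sub_mk, Prod.mk_add_mk] at *
  obtain ⟨ha, hb⟩ := hu0
  obtain ⟨hc, hd⟩ := hv0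
  have hdet' := (abs_eq zero_le_one).mp hdet
  have hca : c ≤ a := le_fst_of_form_lt ha hb hd hdet' hQ
  have hdb : d ≤ b :=
    le_fst_of_form_lt hb ha hc (by rcases hdet' with h | h <;> [right; left] <;> linarith)
      (by linarith)
  have had := mul_nonneg ha hd
  have hcb := mul_nonneg hc hb
  have hpos : 0 < a * d + c * b := by rcases hdet' with h | h <;> linarith
  have hac := mul_nonneg ha hc
  have hbd := mul_nonneg hb hd
  refine ⟨⟨by omega, by omega⟩, ?_, ?_, by linarith⟩
  · rw [← Int.isCoprime_iff_gcd_eq_one]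
    rcases hdet' with h | h
    · exact ⟨d, -c, by linarith⟩
    · exact ⟨-d, c, by linarith⟩
  · have h₁ := mul_nonneg hc (sub_nonneg.mpr hca)
    have h₂ := mul_nonneg hd (sub_nonneg.mpr hdb)
    have h₃ := mul_nonneg hd (sub_nonneg.mpr hca)
    have h₄ := mul_nonneg hc (sub_nonneg.mpr hdb)
    have hcd := mul_nonneg hc hd
    nlinarith [sq_nonneg c, sq_nonneg d]
end

section
/- Let e = (x,y) ∈ ℤ² with x ≥ 1, y ≥ 1 and gcd(x,y) = 1. Then there exists exactly one unordered pair {u, v} of linearly independent primitive vectors of ℤ² with u + v = e such that the closed parallelogram {s·u + t·v : s, t ∈ [0,1]} ⊆ ℝ² contains no lattice point other than its four vertices 0, u, v, e, and Q(e) > Q(u − v) (i.e., e is the longer diagonal of the parallelogram). Moreover, for this unique pair, u and v have nonnegative coordinates and |det(u,v)| = 1; and if x < y, then writing u = (a,b) and v = (c,d), the fractions a/b and c/d are the two Farey neighbors of x/y in the Farey sequence F_y. (The Farey parallelogram for an edge e is thus the unique lattice parallelogram with e as its longer diagonal whose interior is free of lattice points.) -/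
/-- The Farey sequence of order `n`. -/
def Farey (n : ℤ) : Set ℚ := {q | 0 ≤ q ∧ q ≤ 1 ∧ (q.den : ℤ) ≤ n}

/-- Farey neighbors in `F_n`. -/
def FareyNeighbors (n : ℤ) (p q : ℚ) : Prop :=
  p ∈ Farey n ∧ q ∈ Farey n ∧ p < q ∧ ∀ r ∈ Farey n, ¬(p < r ∧ r < q)

/-- The closed parallelogram spanned by `u` and `v` contains no lattice point
other than its four vertices `0, u, v, u+v`. -/
def ParNoLattice (u v : ℤ × ℤ) : Prop :=
  ∀ w : ℤ × ℤ,
    (∃ s t : ℝ, 0 ≤ s ∧ s ≤ 1 ∧ 0 ≤ t ∧ t ≤ 1 ∧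
      (w.1 : ℝ) = s * u.1 + t * v.1 ∧ (w.2 : ℝ) = s * u.2 + t * v.2) →
    w = 0 ∨ w = u ∨ w = v ∨ w = u + v

/-- `{u, v}` is a pair of linearly independent primitive vectors summing to `e`
whose closed parallelogram has no lattice points besides its vertices and has
`e` as its longer diagonal. -/
def GoodPair (e u v : ℤ × ℤ) : Prop :=
  Primitive u ∧ Primitive v ∧ det2 u v ≠ 0 ∧ u + v = e ∧
    ParNoLattice u v ∧ Qval (u - v) < Qval e

theorem det2_swap (u v : ℤ × ℤ) : det2 v u = -det2 u v := by
  unfold det2; ring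

theorem Qval_sub_comm (u v : ℤ × ℤ) : Qval (u - v) = Qval (v - u) := by
  simp only [Qval, Prod.fst_sub, Prod.snd_sub]; ring

theorem ParNoLattice.swap {u v : ℤ × ℤ} (h : ParNoLattice u v) : ParNoLattice v u := by
  rintro w ⟨s, t, hs0, hs1, ht0, ht1, h1, h2⟩
  rcases h w ⟨t, s, ht0, ht1, hs0, hs1, by rw [h1]; ring, by rw [h2]; ring⟩ with h | h | h | h
  · exact Or.inl h
  · exact Or.inr (Or.inr (Or.inl h))
  · exact Or.inr (Or.inl h)
  · exact Or.inr (Or.inr (Or.inr (by rw [h, add_comm])))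

theorem GoodPair.swap {e u v : ℤ × ℤ} (h : GoodPair e u v) : GoodPair e v u := by
  obtain ⟨hu, hv, hd, he, hp, hq⟩ := h
  refine ⟨hv, hu, ?_, by rw [add_comm, he], hp.swap, by rwa [Qval_sub_comm]⟩
  rw [det2_swap]
  exact neg_ne_zero.mpr hd

/-- A primitive vector is the first vector of some lattice basis. -/
theorem Primitive.exists_det2_eq_one {u : ℤ × ℤ} (hu : Primitive u) :
    ∃ w : ℤ × ℤ, det2 u w = 1 := by
  have h := Int.gcd_eq_gcd_ab u.1 u.2
  rw [hu] at h
  exact ⟨(-Int.gcdB u.1 u.2, Int.gcdA u.1 u.2), by unfold det2; push_cast at h; linarith⟩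

theorem primitive_left_of_det2_eq_one {u v : ℤ × ℤ} (h : det2 u v = 1) : Primitive u :=
  Int.isCoprime_iff_gcd_eq_one.mp ⟨v.2, -v.1, by unfold det2 at h; linarith⟩

theorem primitive_right_of_det2_eq_one {u v : ℤ × ℤ} (h : det2 u v = 1) : Primitive v :=
  Int.isCoprime_iff_gcd_eq_one.mp ⟨-u.2, u.1, by unfold det2 at h; linarith⟩

/-- An empty lattice parallelogram spanned by a positively oriented pair has area one. -/
theorem ParNoLattice.det2_eq_one {u v : ℤ × ℤ} (hu : Primitive u) (hd : 0 < det2 u v)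
    (hp : ParNoLattice u v) : det2 u v = 1 := by
  obtain ⟨w, hw⟩ := hu.exists_det2_eq_one
  by_contra hne
  have hD : 1 < det2 u v := by omega
  set D := det2 u v with hDdef
  set r := det2 w v % D with hr
  set m := -(det2 w v / D) with hm
  have hr0 : 0 ≤ r := Int.emod_nonneg _ hd.ne'
  have hrD : r < D := Int.emod_lt_of_pos _ hd
  have hrm : det2 w v + m * D = r := by
    have := Int.emod_add_mul_ediv (det2 w v) D
    rw [hm, hr]; linarith
  have hDR : (0 : ℝ) < D := by exact_mod_cast hd
  have e1 : (w.1 + m * u.1) * D = r * u.1 + v.1 := by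
    rw [← hrm, add_mul, hDdef]
    unfold det2 at hw ⊢
    linear_combination v.1 * hw
  have e2 : (w.2 + m * u.2) * D = r * u.2 + v.2 := by
    rw [← hrm, add_mul, hDdef]
    unfold det2 at hw ⊢
    linear_combination v.2 * hw
  have hdet : det2 u (w.1 + m * u.1, w.2 + m * u.2) = 1 := by
    unfold det2 at hw ⊢
    linear_combination hw
  have key := hp (w.1 + m * u.1, w.2 + m * u.2) ⟨r / D, 1 / D, by positivity, by
    rw [div_le_one hDR]; exact_mod_cast hrD.le, by positivity, by
    rw [div_le_one hDR]; exact_mod_cast hD.le, by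
    field_simp; exact_mod_cast e1, by
    field_simp; exact_mod_cast e2⟩
  rcases key with h | h | h | h <;> rw [h] at hdet
  · simp [det2] at hdet
  · unfold det2 at hdet; linarith
  · omega
  · have : det2 u (u + v) = D := by
      rw [hDdef]; simp only [det2, Prod.fst_add, Prod.snd_add]; ring
    omega

theorem parNoLattice_of_det2_eq_one {u v : ℤ × ℤ} (h : det2 u v = 1) : ParNoLattice u v := by
  rintro w ⟨s, t, hs0, hs1, ht0, ht1, h1, h2⟩
  have hR : (u.1 * v.2 - v.1 * u.2 : ℝ) = 1 := by
    unfold det2 at h; exact_mod_cast h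
  have hs : s = (det2 w v : ℤ) := by
    unfold det2; push_cast; rw [h1, h2]; linear_combination -s * hR
  have ht : t = (det2 u w : ℤ) := by
    unfold det2; push_cast; rw [h1, h2]; linear_combination -t * hR
  have e1 : w.1 = det2 w v * u.1 + det2 u w * v.1 := by
    rw [hs, ht] at h1; exact_mod_cast h1
  have e2 : w.2 = det2 w v * u.2 + det2 u w * v.2 := by
    rw [hs, ht] at h2; exact_mod_cast h2
  rw [hs] at hs0 hs1
  rw [ht] at ht0 ht1
  norm_cast at hs0 hs1 ht0 ht1
  generalize det2 w v = m at *
  generalize det2 u w = n at *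
  have hm : m = 0 ∨ m = 1 := by omega
  have hn : n = 0 ∨ n = 1 := by omega
  rcases hm with rfl | rfl <;> rcases hn with rfl | rfl
  · exact Or.inl (Prod.ext (by simpa using e1) (by simpa using e2))
  · exact Or.inr (Or.inr (Or.inl (Prod.ext (by simpa using e1) (by simpa using e2))))
  · exact Or.inr (Or.inl (Prod.ext (by simpa using e1) (by simpa using e2)))
  · exact Or.inr (Or.inr (Or.inr (Prod.ext (by simpa using e1) (by simpa using e2))))

/-- The short diagonal of a parallelogram with nonnegative sides. -/
theorem Qval_sub_lt_Qval_add {u v : ℤ × ℤ} (h : det2 u v = 1) (hu1 : 0 ≤ u.1) (hu2 : 0 ≤ u.2)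
    (hv1 : 0 ≤ v.1) (hv2 : 0 ≤ v.2) : Qval (u - v) < Qval (u + v) := by
  simp only [Qval, det2, Prod.fst_add, Prod.snd_add, Prod.fst_sub, Prod.snd_sub] at *
  nlinarith [mul_nonneg hu1 hv1, mul_nonneg hu2 hv2, mul_nonneg hu1 hv2, mul_nonneg hv1 hu2]

theorem Qval_nonneg (u : ℤ × ℤ) : 0 ≤ Qval u := by
  unfold Qval
  nlinarith [sq_nonneg (u.1 + u.2), sq_nonneg u.1, sq_nonneg u.2]

/-- Two positively oriented bases with the same sum, both having that sum as the longer diagonal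
of their parallelogram, coincide. -/
theorem eq_of_det2_eq_one_of_Qval_lt {e u v u' v' : ℤ × ℤ} (he : Primitive e)
    (hd : det2 u v = 1) (hd' : det2 u' v' = 1) (hs : u + v = e) (hs' : u' + v' = e)
    (hq : Qval (u - v) < Qval e) (hq' : Qval (u' - v') < Qval e) : u' = u ∧ v' = v := by
  obtain ⟨w, hw⟩ := he.exists_det2_eq_one
  obtain ⟨a, b⟩ := u
  obtain ⟨c, d⟩ := v
  obtain ⟨a', b'⟩ := u'
  obtain ⟨c', d'⟩ := v'
  subst hs
  obtain ⟨h1, h2⟩ : a' + c' = a + c ∧ b' + d' = b + d := by simpa using hs'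
  obtain rfl : c' = a + c - a' := by linarith
  obtain rfl : d' = b + d - b' := by linarith
  simp only [det2, Prod.mk_add_mk] at hd hd' hw
  obtain ⟨k, hk1, hk2⟩ : ∃ k, a' = a + k * (a + c) ∧ b' = b + k * (b + d) := by
    refine ⟨(a' - a) * w.2 - w.1 * (b' - b), ?_, ?_⟩
    · linear_combination (-(a' - a)) * hw + w.1 * (hd - hd')
    · linear_combination (-(b' - b)) * hw + w.2 * (hd - hd')
  subst hk1 hk2
  have hu := Qval_nonneg (a, b)
  have hv := Qval_nonneg (c, d)
  simp only [Qval, Prod.mk_add_mk, Prod.mk_sub_mk] at hq hq' hu hv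
  set B := 2 * a * c + a * d + b * c + 2 * b * d with hB
  set U := a ^ 2 + a * b + b ^ 2 with hU
  set V := c ^ 2 + c * d + d ^ 2 with hV
  have hB0 : 0 < B := by rw [hB]; linarith
  have hk : 0 < B + 2 * k * (V - U) - 2 * k ^ 2 * (U + V + B) := by
    rw [hB, hU, hV]; linarith
  clear_value B U V
  have hk0 : k = 0 := by
    by_contra hne
    have hpos : 1 ≤ k ^ 2 := Int.add_one_le_iff.mpr (sq_pos_of_ne_zero hne)
    have hle : k ≤ k ^ 2 := Int.le_self_sq k
    have hle' : -k ≤ k ^ 2 := by simpa using Int.le_self_sq (-k)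
    linarith [mul_nonneg (sub_nonneg.mpr hle) hv, mul_nonneg (sub_nonneg.mpr hle') hu,
      mul_nonneg (sub_nonneg.mpr hpos) hB0.le]
  subst hk0
  simp

/-- A nonnegative vector completing a primitive positive vector to a positively oriented basis. -/
theorem exists_det2_eq_one_of_pos {x y : ℤ} (hx : 1 ≤ x) (hy : 1 ≤ y) (hcop : Int.gcd x y = 1) :
    ∃ a b : ℤ, 0 < a ∧ a ≤ x ∧ 0 ≤ b ∧ b < y ∧ a * y - x * b = 1 := by
  obtain ⟨w, hw⟩ := Primitive.exists_det2_eq_one (u := (x, y)) hcop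
  simp only [det2] at hw
  have hb0 : 0 ≤ -w.2 % y := Int.emod_nonneg _ (by omega)
  have hby : -w.2 % y < y := Int.emod_lt_of_pos _ (by omega)
  have hdiv := Int.emod_add_mul_ediv (-w.2) y
  set b := -w.2 % y
  set q := -w.2 / y
  have hab : (-w.1 - x * q) * y - x * b = 1 := by
    linear_combination hw - x * hdiv
  refine ⟨-w.1 - x * q, b, ?_, ?_, hb0, hby, hab⟩ <;> by_contra! h <;> nlinarith

/-- A fraction `a / b` in `[0, 1]` with `0 < b ≤ n` belongs to the Farey sequence of order `n`. -/
theorem div_mem_Farey {a b n : ℤ} (ha : 0 ≤ a) (hab : a ≤ b) (hb : 0 < b) (hn : b ≤ n) :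
    (a : ℚ) / b ∈ Farey n := by
  have hbq : (0 : ℚ) < b := by exact_mod_cast hb
  refine ⟨by positivity, ?_, (Int.le_of_dvd hb ?_).trans hn⟩
  · rw [div_le_one hbq]; exact_mod_cast hab
  · rw [← Rat.divInt_eq_div]; exact Rat.den_dvd a b

/-- Unimodular fractions `a / b < c / d` in `F_n` with `n < b + d` are Farey neighbors. -/
theorem fareyNeighbors_of_unimodular {a b c d n : ℤ} (hb : 0 < b) (hd : 0 < d)
    (h : c * b - a * d = 1) (hn : n < b + d) (h1 : (a : ℚ) / b ∈ Farey n)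
    (h2 : (c : ℚ) / d ∈ Farey n) : FareyNeighbors n ((a : ℚ) / b) ((c : ℚ) / d) := by
  have hbq : (0 : ℚ) < b := by exact_mod_cast hb
  have hdq : (0 : ℚ) < d := by exact_mod_cast hd
  refine ⟨h1, h2, ?_, ?_⟩
  · rw [div_lt_div_iff₀ hbq hdq]
    norm_cast
    linarith
  · rintro r ⟨-, -, hr⟩ ⟨hl, hu⟩
    have hq : (0 : ℚ) < (r.den : ℤ) := by exact_mod_cast r.den_pos
    have hreq : r = (r.num : ℚ) / (r.den : ℤ) := by
      push_cast; exact (Rat.num_div_den r).symm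
    rw [hreq, div_lt_div_iff₀ hbq hq] at hl
    rw [hreq, div_lt_div_iff₀ hq hdq] at hu
    norm_cast at hl hu
    have : (r.den : ℤ) = b * (c * r.den - r.num * d) + d * (r.num * b - a * r.den) := by
      linear_combination (-(r.den : ℤ)) * h
    nlinarith

/-- For a primitive vector `e = (x,y)` with positive coordinates there is
exactly one unordered pair `{u,v}` of linearly independent primitive vectors
with `u + v = e` whose closed parallelogram contains no lattice point besides
its vertices and has `e` as longer diagonal; for this pair, `u` and `v` have
nonnegative coordinates and `|det(u,v)| = 1`, and if `x < y` then (writing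
`u = (a,b)`, `v = (c,d)`) the fractions `a/b` and `c/d` are the two Farey
neighbors of `x/y` in the Farey sequence `F_y`. -/
theorem stmt4 (x y : ℤ) (hx : 1 ≤ x) (hy : 1 ≤ y) (hcop : Int.gcd x y = 1) :
    ∃ u v : ℤ × ℤ, GoodPair (x, y) u v ∧
      (∀ u' v' : ℤ × ℤ, GoodPair (x, y) u' v' →
        (u' = u ∧ v' = v) ∨ (u' = v ∧ v' = u)) ∧
      (0 ≤ u.1 ∧ 0 ≤ u.2 ∧ 0 ≤ v.1 ∧ 0 ≤ v.2) ∧ |det2 u v| = 1 ∧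
      (x < y →
        ((FareyNeighbors y ((u.1 : ℚ) / (u.2 : ℚ)) ((x : ℚ) / y) ∧
            FareyNeighbors y ((x : ℚ) / y) ((v.1 : ℚ) / (v.2 : ℚ))) ∨
          (FareyNeighbors y ((v.1 : ℚ) / (v.2 : ℚ)) ((x : ℚ) / y) ∧
            FareyNeighbors y ((x : ℚ) / y) ((u.1 : ℚ) / (u.2 : ℚ))))) := by
  obtain ⟨a, b, ha, hax, hb, hby, hab⟩ := exists_det2_eq_one_of_pos hx hy hcop
  have hdet : det2 (a, b) (x - a, y - b) = 1 := by
    simp only [det2]; linear_combination hab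
  have hsum : ((a, b) : ℤ × ℤ) + (x - a, y - b) = (x, y) := by simp
  have hc : 0 ≤ x - a := by omega
  have hd : 0 < y - b := by omega
  have hq : Qval ((a, b) - (x - a, y - b)) < Qval (x, y) := by
    rw [← hsum]; exact Qval_sub_lt_Qval_add hdet ha.le hb hc hd.le
  refine ⟨(a, b), (x - a, y - b), ⟨primitive_left_of_det2_eq_one hdet,
    primitive_right_of_det2_eq_one hdet, by rw [hdet]; exact one_ne_zero, hsum,
    parNoLattice_of_det2_eq_one hdet, hq⟩, ?_, ⟨ha.le, hb, hc, hd.le⟩, by rw [hdet, abs_one], ?_⟩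
  · have unique : ∀ u' v' : ℤ × ℤ, GoodPair (x, y) u' v' → 0 < det2 u' v' →
        u' = (a, b) ∧ v' = (x - a, y - b) := fun u' v' ⟨hu', _, _, hs', hp', hq'⟩ hpos =>
      eq_of_det2_eq_one_of_Qval_lt (e := (x, y)) hcop hdet (hp'.det2_eq_one hu' hpos) hsum hs' hq hq'
    intro u' v' hg
    rcases lt_or_gt_of_ne hg.2.2.1 with h | h
    · exact Or.inr (unique v' u' hg.swap (by rw [det2_swap]; omega)).symm
    · exact Or.inl (unique u' v' hg h)
  · intro hxy
    have hb1 : 0 < b := by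
      rcases hb.eq_or_lt with rfl | h
      · nlinarith
      · exact h
    have hmem : (x : ℚ) / y ∈ Farey y := div_mem_Farey (by omega) hxy.le (by omega) le_rfl
    refine Or.inr ⟨fareyNeighbors_of_unimodular hd (by omega) (by linear_combination hab)
      (by omega) (div_mem_Farey hc ?_ hd (by omega)) hmem,
      fareyNeighbors_of_unimodular (by omega) hb1 hab (by omega) hmem
      (div_mem_Farey ha.le ?_ hb1 hby.le)⟩
    · by_contra! h
      nlinarith
    · by_contra! h
      nlinarith
end

section
/- Let e = (x,y) ∈ ℤ² with x ≥ 1, y ≥ 1 and gcd(x,y) = 1, and let {u, v} be the sides of the Farey parallelogram of e, i.e., the unique pair of primitive vectors with nonnegative coordinates satisfying u + v = e and |det(u,v)| = 1. Let p₁, p₂, p₃, p₄ ∈ ℤ² be the vertices, in cyclic order, of a convex quadrilateral (the four points are in convex position) with p₃ − p₁ = e. Suppose the closed convex hull of {p₁, p₂, p₃, p₄} in ℝ² contains no lattice point other than these four vertices, and Q(p₃ − p₁) > Q(p₄ − p₂) (i.e., e is the longer diagonal of the quadrilateral). Then the quadrilateral is a translate of the Farey parallelogram of e: p₁ + p₃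 = p₂ + p₄ and {p₂ − p₁, p₄ − p₁} = {u, v}. -/
/-- The canonical embedding of the lattice `ℤ²` into the plane `ℝ²`. -/
def toR (p : ℤ × ℤ) : ℝ × ℝ := ((p.1 : ℝ), (p.2 : ℝ))

/-- A lattice point given by barycentric coordinates lies in the triangle. -/
theorem toR_mem_convexHull_triple {P A B C : ℤ × ℤ} {α β γ : ℝ} (hα : 0 ≤ α) (hβ : 0 ≤ β)
    (hγ : 0 ≤ γ) (h : α + β + γ = 1) (h₁ : α * A.1 + β * B.1 + γ * C.1 = P.1)
    (h₂ : α * A.2 + β * B.2 + γ * C.2 = P.2) :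
    toR P ∈ convexHull ℝ ({toR A, toR B, toR C} : Set (ℝ × ℝ)) := by
  have hP : toR P = ∑ i, ![α, β, γ] i • ![toR A, toR B, toR C] i := by
    ext <;> simp [Fin.sum_univ_three, toR, ← h₁, ← h₂]
  rw [hP]
  refine (convex_convexHull ℝ _).sum_mem ?_ ?_ ?_
  · intro i _
    fin_cases i <;> simpa
  · simpa [Fin.sum_univ_three] using h
  · intro i _
    apply subset_convexHull
    fin_cases i <;> simp

theorem exists_det2_eq_one {e : ℤ × ℤ} (he : Primitive e) : ∃ f, det2 e f = 1 := by
  refine ⟨(-Int.gcdB e.1 e.2, Int.gcdA e.1 e.2), ?_⟩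
  have h := Int.gcd_eq_gcd_ab e.1 e.2
  rw [he] at h
  simp only [det2]
  push_cast at h
  linarith

/-- Vectors with vanishing determinant against a primitive `e` are multiples of `e`. -/
theorem exists_eq_smul_of_det2_eq_zero {e a : ℤ × ℤ} (he : Primitive e) (h : det2 e a = 0) :
    ∃ k : ℤ, a = k • e := by
  obtain ⟨f, hf⟩ := exists_det2_eq_one he
  refine ⟨det2 a f, ?_⟩
  simp only [det2] at *
  ext <;> simp only [Prod.smul_fst, Prod.smul_snd, smul_eq_mul]
  · linear_combination (-a.1) * hf + f.1 * h
  · linear_combination (-a.2) * hf + f.2 * h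

/-- A lattice triangle with a primitive side and more than the minimal area contains a lattice
point other than its vertices. -/
theorem exists_lattice_point_of_two_le_abs_det2 {e a : ℤ × ℤ} (p : ℤ × ℤ) (he : Primitive e)
    (h : 2 ≤ |det2 e a|) :
    ∃ w, toR w ∈ convexHull ℝ ({toR p, toR (p + a), toR (p + e)} : Set (ℝ × ℝ)) ∧
      w ≠ p ∧ w ≠ p + a ∧ w ≠ p + e := by
  obtain ⟨f, k, D, hD, hef, rfl⟩ :
      ∃ (f : ℤ × ℤ) (k D : ℤ), 2 ≤ D ∧ det2 e f ≠ 0 ∧ a = D • f + k • e := by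
    obtain ⟨f, hf⟩ := exists_det2_eq_one he
    have key : a = det2 e a • f + det2 a f • e := by
      simp only [det2] at *
      ext <;> simp only [Prod.fst_add, Prod.snd_add, Prod.smul_fst, Prod.smul_snd, smul_eq_mul]
      · linear_combination (-a.1) * hf
      · linear_combination (-a.2) * hf
    rcases le_abs.1 h with h | h
    · exact ⟨f, det2 a f, det2 e a, h, by rw [hf]; exact one_ne_zero, key⟩
    · refine ⟨-f, det2 a f, -det2 e a, h, ?_, by simpa using key⟩
      have : det2 e (-f) = -det2 e f := by simp only [det2, Prod.fst_neg, Prod.snd_neg]; ring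
      rw [this, hf]
      decide
  set j : ℤ := -((-k) / D) with hj
  have hk := Int.mul_ediv_add_emod (-k) D
  have hr := Int.emod_nonneg (-k) (show D ≠ 0 by omega)
  have hr' := Int.emod_lt_of_pos (-k) (show 0 < D by omega)
  have h1 : k ≤ j * D := by rw [hj]; linarith
  have h2 : j * D ≤ k + D - 1 := by rw [hj]; linarith
  have h1' : (k : ℝ) ≤ j * D := by exact_mod_cast h1
  have h2' : (j : ℝ) * D ≤ k + D - 1 := by exact_mod_cast h2
  have hD0 : (0 : ℝ) < D := by exact_mod_cast (show 0 < D by omega)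
  refine ⟨p + (f + j • e), toR_mem_convexHull_triple (α := (k + D - 1 - j * D) / D)
    (β := 1 / D) (γ := (j * D - k) / D) (div_nonneg (by linarith) hD0.le) (by positivity)
    (div_nonneg (by linarith) hD0.le) (by field_simp; ring) ?_ ?_, ?_⟩
  · simp
    field_simp
    ring
  · simp
    field_simp
    ring
  · have hdet : ∀ c d : ℤ, f + j • e = c • f + d • e → c = 1 := by
      intro c d hc
      have h₁ := congrArg Prod.fst hc
      have h₂ := congrArg Prod.snd hc
      simp only [Prod.fst_add, Prod.snd_add, Prod.smul_fst, Prod.smul_snd, smul_eq_mul] at h₁ h₂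
      refine mul_right_cancel₀ hef ?_
      simp only [det2]
      linear_combination e.2 * h₁ - e.1 * h₂
    refine ⟨fun hw => ?_, fun hw => ?_, fun hw => ?_⟩
    · have := hdet 0 0 (by simpa using hw)
      omega
    · have := hdet D k (add_left_cancel hw)
      omega
    · have := hdet 0 1 (by simpa using hw)
      omega

/-- Shearing the Farey parallelogram of `u + v` along `u + v` by a nonzero amount makes its other
diagonal at least as long as `u + v`. -/
theorem eq_zero_of_Qval_lt {u v : ℤ × ℤ} {m : ℤ} (hu : 0 ≤ u.1 ∧ 0 ≤ u.2)
    (hv : 0 ≤ v.1 ∧ 0 ≤ v.2)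
    (h : Qval ((v - m • (u + v)) - (u + m • (u + v))) < Qval (u + v)) : m = 0 := by
  by_contra hm
  obtain ⟨hu1, hu2⟩ := hu
  obtain ⟨hv1, hv2⟩ := hv
  have hB : 0 ≤ 2 * u.1 * v.1 + u.1 * v.2 + u.2 * v.1 + 2 * u.2 * v.2 := by positivity
  have hU : 0 ≤ Qval u := by simp only [Qval]; positivity
  have hV : 0 ≤ Qval v := by simp only [Qval]; positivity
  have hm2 : 1 ≤ m ^ 2 := pow_pos (abs_pos.2 hm) 2 |>.trans_eq (sq_abs m)
  have hα : 0 ≤ 4 * m ^ 2 + 4 * m := by nlinarith [Int.le_self_sq m, Int.le_self_sq (-m)]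
  have hβ : 0 ≤ 4 * m ^ 2 - 4 * m := by nlinarith [Int.le_self_sq m, Int.le_self_sq (-m)]
  have e1 := mul_nonneg hα hU
  have e2 := mul_nonneg hβ hV
  have e3 := mul_nonneg (show 0 ≤ 4 * m ^ 2 - 2 by linarith) hB
  simp only [Qval, Prod.fst_add, Prod.snd_add, Prod.fst_sub, Prod.snd_sub, Prod.smul_fst,
    Prod.smul_snd, smul_eq_mul] at *
  nlinarith

/-- If a parallelogram with sides `a`, `b` has diagonal `u + v` and a shorter other diagonal, and
`a` is at the same height over `u + v` as `u`, then `a = u` and `b = v`. -/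
theorem eq_of_det2_eq {u v a b : ℤ × ℤ} (he : Primitive (u + v)) (hu : 0 ≤ u.1 ∧ 0 ≤ u.2)
    (hv : 0 ≤ v.1 ∧ 0 ≤ v.2) (hab : a + b = u + v) (hdet : det2 (u + v) a = det2 (u + v) u)
    (h : Qval (b - a) < Qval (u + v)) : a = u ∧ b = v := by
  obtain ⟨m, hm⟩ := exists_eq_smul_of_det2_eq_zero (a := a - u) he (by
    simp only [det2, Prod.fst_sub, Prod.snd_sub] at *; linear_combination hdet)
  have ha : a = u + m • (u + v) := by rw [← hm]; abel
  have hb : b = v - m • (u + v) := by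
    rw [← hm, eq_sub_of_add_eq' hab]; abel
  have hm0 := eq_zero_of_Qval_lt hu hv (ha ▸ hb ▸ h)
  subst hm0
  simp at ha hb
  exact ⟨ha, hb⟩

/-- If the segments from `p` to `p + e` and from `p + a` to `p + b` cross and the four endpoints
are in convex position, then `p + a` and `p + b` lie strictly on opposite sides of the first. -/
theorem det2_mul_det2_neg {p e a b : ℤ × ℤ} (he : Primitive e)
    (h₁ : toR p ∉ convexHull ℝ ({toR (p + a), toR (p + e), toR (p + b)} : Set (ℝ × ℝ)))
    (h₂ : toR (p + a) ∉ convexHull ℝ ({toR p, toR (p + e), toR (p + b)} : Set (ℝ × ℝ)))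
    (h₄ : toR (p + b) ∉ convexHull ℝ ({toR p, toR (p + a), toR (p + e)} : Set (ℝ × ℝ)))
    {s t : ℝ} (hs : 0 ≤ s) (hs' : s ≤ 1) (ht : 0 ≤ t) (ht' : t ≤ 1)
    (hst₁ : s * e.1 = (1 - t) * a.1 + t * b.1) (hst₂ : s * e.2 = (1 - t) * a.2 + t * b.2) :
    det2 e a * det2 e b < 0 := by
  have hd : (1 - t) * (det2 e a : ℝ) + t * det2 e b = 0 := by
    simp only [det2]
    push_cast
    linear_combination e.2 * hst₁ - e.1 * hst₂
  have ht0 : t ≠ 0 := by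
    rintro rfl
    refine h₂ (toR_mem_convexHull_triple (α := 1 - s) (β := s) (γ := 0) (by linarith) hs le_rfl
      (by ring) ?_ ?_) <;> simp <;> linarith
  have ht1 : t ≠ 1 := by
    rintro rfl
    refine h₄ (toR_mem_convexHull_triple (α := 1 - s) (β := 0) (γ := s) (by linarith) le_rfl hs
      (by ring) ?_ ?_) <;> simp <;> linarith
  have ht0 : 0 < t := lt_of_le_of_ne ht (Ne.symm ht0)
  have ht1 : t < 1 := lt_of_le_of_ne ht' ht1
  by_cases ha : det2 e a = 0
  · have hb : det2 e b = 0 := by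
      have : t * (det2 e b : ℝ) = 0 := by simpa [ha] using hd
      exact_mod_cast (mul_eq_zero.1 this).resolve_left ht0.ne'
    obtain ⟨k, rfl⟩ := exists_eq_smul_of_det2_eq_zero he ha
    obtain ⟨l, rfl⟩ := exists_eq_smul_of_det2_eq_zero he hb
    exfalso
    simp only [Prod.smul_fst, Prod.smul_snd, smul_eq_mul, Int.cast_mul] at hst₁ hst₂
    have hs_eq : s = (1 - t) * k + t * l := by
      obtain ⟨f, hf⟩ := exists_det2_eq_one he
      have hf' : (e.1 * f.2 - f.1 * e.2 : ℝ) = 1 := by exact_mod_cast hf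
      linear_combination f.2 * hst₁ - f.1 * hst₂ - (s - (1 - t) * k - t * l) * hf'
    have hk : k < 0 ∨ 1 < k := by
      by_contra! hk
      have hk0 : (0 : ℝ) ≤ k := by exact_mod_cast hk.1
      have hk1 : (k : ℝ) ≤ 1 := by exact_mod_cast hk.2
      refine h₂ (toR_mem_convexHull_triple (α := 1 - k) (β := k) (γ := 0) (by linarith) hk0 le_rfl
        (by ring) ?_ ?_) <;> simp <;> ring
    have hl : l < 0 ∨ 1 < l := by
      by_contra! hl
      have hl0 : (0 : ℝ) ≤ l := by exact_mod_cast hl.1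
      have hl1 : (l : ℝ) ≤ 1 := by exact_mod_cast hl.2
      refine h₄ (toR_mem_convexHull_triple (α := 1 - l) (β := 0) (γ := l) (by linarith) le_rfl hl0
        (by ring) ?_ ?_) <;> simp <;> ring
    rcases hk with hk | hk <;> rcases hl with hl | hl <;>
      have hk' := (Int.cast_lt (R := ℝ)).2 hk <;> have hl' := (Int.cast_lt (R := ℝ)).2 hl <;>
      push_cast at hk' hl'
    · nlinarith
    · have hlk : (l - k : ℝ) ≠ 0 := by linarith
      refine h₁ (toR_mem_convexHull_triple (α := l / (l - k)) (β := 0) (γ := -k / (l - k))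
        (div_nonneg (by linarith) (by linarith)) le_rfl (div_nonneg (by linarith) (by linarith))
        (by field_simp; ring) ?_ ?_) <;> simp <;> field_simp <;> ring
    · have hlk : (k - l : ℝ) ≠ 0 := by linarith
      refine h₁ (toR_mem_convexHull_triple (α := -l / (k - l)) (β := 0) (γ := k / (k - l))
        (div_nonneg (by linarith) (by linarith)) le_rfl (div_nonneg (by linarith) (by linarith))
        (by field_simp; ring) ?_ ?_) <;> simp <;> field_simp <;> ring
    · nlinarith
  · have ha2 : (0 : ℝ) < (det2 e a : ℝ) ^ 2 := by
      have : (det2 e a : ℝ) ≠ 0 := by exact_mod_cast ha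
      positivity
    have h0 : t * ((det2 e a : ℝ) * det2 e b) < 0 := by
      have := mul_pos (sub_pos.2 ht1) ha2
      linear_combination this + (det2 e a : ℝ) * hd
    have := neg_of_mul_neg_right h0 ht
    exact_mod_cast this

/-- Crossing diagonals of a convex quadrilateral whose other two vertices are at equal heights over
the primitive diagonal `e` bisect each other. -/
theorem add_eq_of_det2_add_eq_zero {p e a b : ℤ × ℤ} (he : Primitive e)
    (h₁ : toR p ∉ convexHull ℝ ({toR (p + a), toR (p + e), toR (p + b)} : Set (ℝ × ℝ)))
    (h₃ : toR (p + e) ∉ convexHull ℝ ({toR p, toR (p + a), toR (p + b)} : Set (ℝ × ℝ)))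
    {s t : ℝ} (hs : 0 ≤ s) (hs' : s ≤ 1)
    (hst₁ : s * e.1 = (1 - t) * a.1 + t * b.1) (hst₂ : s * e.2 = (1 - t) * a.2 + t * b.2)
    (ha : det2 e a ≠ 0) (hab : det2 e a + det2 e b = 0) : a + b = e := by
  obtain ⟨c, hc⟩ := exists_eq_smul_of_det2_eq_zero (a := a + b) he (by
    simp only [det2, Prod.fst_add, Prod.snd_add] at *; linear_combination hab)
  have ht : t = 1 / 2 := by
    have ha' : (det2 e a : ℝ) ≠ 0 := by exact_mod_cast ha
    have hab' : (det2 e a + det2 e b : ℝ) = 0 := by exact_mod_cast hab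
    have hd : (1 - t) * (det2 e a : ℝ) + t * det2 e b = 0 := by
      simp only [det2]
      push_cast
      linear_combination e.2 * hst₁ - e.1 * hst₂
    refine mul_right_cancel₀ ha' ?_
    linear_combination (-1 / 2) * hd + (t / 2) * hab'
  subst ht
  have hc₁ : (a.1 + b.1 : ℝ) = c * e.1 := by exact_mod_cast congrArg Prod.fst hc
  have hc₂ : (a.2 + b.2 : ℝ) = c * e.2 := by exact_mod_cast congrArg Prod.snd hc
  have hcs : (c : ℝ) = 2 * s := by
    obtain ⟨f, hf⟩ := exists_det2_eq_one he
    have hf' : (e.1 * f.2 - f.1 * e.2 : ℝ) = 1 := by exact_mod_cast hf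
    linear_combination (-2 * f.2) * hst₁ + 2 * f.1 * hst₂ - f.2 * hc₁ + f.1 * hc₂
      - (c - 2 * s) * hf'
  have hc0 : 0 ≤ c := by exact_mod_cast (show (0 : ℝ) ≤ c by linarith)
  have hc2 : c ≤ 2 := by exact_mod_cast (show (c : ℝ) ≤ 2 by linarith)
  interval_cases c
  · exfalso
    push_cast at hc₁ hc₂
    refine h₁ (toR_mem_convexHull_triple (α := 1 / 2) (β := 0) (γ := 1 / 2) (by norm_num) le_rfl
      (by norm_num) (by norm_num) ?_ ?_) <;> simp <;> linarith
  · simpa using hc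
  · exfalso
    push_cast at hc₁ hc₂
    refine h₃ (toR_mem_convexHull_triple (α := 0) (β := 1 / 2) (γ := 1 / 2) le_rfl (by norm_num)
      (by norm_num) (by norm_num) ?_ ?_) <;> simp <;> linarith

/-- Let `e = (x,y)` be primitive with positive coordinates and let `{u,v}` be
the sides of the Farey parallelogram of `e`.  If `p₁ p₂ p₃ p₄` are, in cyclic
order, the vertices of a convex quadrilateral whose closed convex hull contains
no lattice point besides the four vertices, with `p₃ − p₁ = e` its longer
diagonal, then the quadrilateral is a translate of the Farey parallelogram:
`p₁ + p₃ = p₂ + p₄` and `{p₂ − p₁, p₄ − p₁} = {u, v}`. -/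
theorem stmt5 (x y : ℤ) (hx : 1 ≤ x) (hy : 1 ≤ y) (hcop : Int.gcd x y = 1)
    (u v : ℤ × ℤ) (hu : Primitive u) (hv : Primitive v)
    (hu0 : 0 ≤ u.1 ∧ 0 ≤ u.2) (hv0 : 0 ≤ v.1 ∧ 0 ≤ v.2)
    (hsum : u + v = (x, y)) (hdet : |det2 u v| = 1)
    (p₁ p₂ p₃ p₄ : ℤ × ℤ)
    -- the four points are in convex position:
    (hcp₁ : toR p₁ ∉ convexHull ℝ ({toR p₂, toR p₃, toR p₄} : Set (ℝ × ℝ)))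
    (hcp₂ : toR p₂ ∉ convexHull ℝ ({toR p₁, toR p₃, toR p₄} : Set (ℝ × ℝ)))
    (hcp₃ : toR p₃ ∉ convexHull ℝ ({toR p₁, toR p₂, toR p₄} : Set (ℝ × ℝ)))
    (hcp₄ : toR p₄ ∉ convexHull ℝ ({toR p₁, toR p₂, toR p₃} : Set (ℝ × ℝ)))
    -- cyclic order: the diagonals `p₁p₃` and `p₂p₄` cross:
    (hcyc : (segment ℝ (toR p₁) (toR p₃) ∩ segment ℝ (toR p₂) (toR p₄)).Nonempty)
    (hdiag : p₃ - p₁ = (x, y))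
    -- no lattice point in the closed quadrilateral other than the vertices:
    (hlat : ∀ w : ℤ × ℤ,
      toR w ∈ convexHull ℝ ({toR p₁, toR p₂, toR p₃, toR p₄} : Set (ℝ × ℝ)) →
      w = p₁ ∨ w = p₂ ∨ w = p₃ ∨ w = p₄)
    -- `e = p₃ − p₁` is the longer diagonal:
    (hlonger : Qval (p₄ - p₂) < Qval (p₃ - p₁)) :
    p₁ + p₃ = p₂ + p₄ ∧
      ((p₂ - p₁ = u ∧ p₄ - p₁ = v) ∨ (p₂ - p₁ = v ∧ p₄ - p₁ = u)) := by
  obtain ⟨a, rfl⟩ : ∃ a, p₂ = p₁ + a := ⟨p₂ - p₁, by abel⟩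
  obtain ⟨b, rfl⟩ : ∃ b, p₄ = p₁ + b := ⟨p₄ - p₁, by abel⟩
  obtain rfl : p₃ = p₁ + (u + v) := by rw [hsum, ← hdiag]; abel
  have he : Primitive (u + v) := by rw [hsum]; exact hcop
  obtain ⟨z, ⟨s', s, hs₀, hs, hss, rfl⟩, ⟨t', t, ht₀, ht, htt, hz⟩⟩ := hcyc
  obtain rfl : s' = 1 - s := by linarith
  obtain rfl : t' = 1 - t := by linarith
  have hst₁ : s * (u + v).1 = (1 - t) * a.1 + t * b.1 := by
    have := congrArg Prod.fst hz
    simp [toR] at this ⊢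
    linarith
  have hst₂ : s * (u + v).2 = (1 - t) * a.2 + t * b.2 := by
    have := congrArg Prod.snd hz
    simp [toR] at this ⊢
    linarith
  have hneg := det2_mul_det2_neg he hcp₁ hcp₂ hcp₄ hs (by linarith) ht (by linarith) hst₁ hst₂
  have ha : |det2 (u + v) a| < 2 := by
    by_contra! h
    obtain ⟨w, hw, hw₁, hw₂, hw₃⟩ := exists_lattice_point_of_two_le_abs_det2 p₁ he h
    rcases hlat w (convexHull_mono (by grind) hw) with h | h | h | rfl
    exacts [hw₁ h, hw₂ h, hw₃ h, hcp₄ (convexHull_mono (by grind) hw)]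
  have hb : |det2 (u + v) b| < 2 := by
    by_contra! h
    obtain ⟨w, hw, hw₁, hw₂, hw₃⟩ := exists_lattice_point_of_two_le_abs_det2 p₁ he h
    rcases hlat w (convexHull_mono (by grind) hw) with h | rfl | h | h
    exacts [hw₁ h, hcp₂ (convexHull_mono (by grind) hw), hw₃ h, hw₂ h]
  have hsign : (det2 (u + v) a = 1 ∧ det2 (u + v) b = -1) ∨
      (det2 (u + v) a = -1 ∧ det2 (u + v) b = 1) := by
    rw [abs_lt] at ha hb
    rcases mul_neg_iff.1 hneg with h | h <;> omega
  have hab : a + b = u + v := add_eq_of_det2_add_eq_zero he hcp₁ hcp₃ hs (by linarith) hst₁ hst₂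
    (by omega) (by omega)
  have hQ : Qval (b - a) < Qval (u + v) := by simpa using hlonger
  have hu' : det2 (u + v) u = -det2 u v := by
    simp only [det2, Prod.fst_add, Prod.snd_add]; ring
  have hv' : det2 (v + u) v = det2 u v := by
    simp only [det2, Prod.fst_add, Prod.snd_add]; ring
  refine ⟨by rw [← hab]; abel, ?_⟩
  simp only [add_sub_cancel_left]
  by_cases h : det2 (u + v) a = det2 (u + v) u
  · exact Or.inl (eq_of_det2_eq he hu0 hv0 hab h hQ)
  · right
    rw [add_comm u v] at *
    refine eq_of_det2_eq he hv0 hu0 hab ?_ hQ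
    rcases eq_or_eq_neg_of_abs_eq hdet with hd | hd <;> omega
end

section
/- Let u, e ∈ ℤ² with |det(u,e)| = 1. Then every lattice point w ∈ ℤ² lying in the open cone {s·u + t·e : s, t > 0 real} ⊆ ℝ² can be written as w = m·u + n·e with integers m ≥ 1 and n ≥ 1. Consequently, if in addition u and e have nonnegative coordinates, then Q(w) ≥ Q(u + e) > Q(e) for every such w; that is, no lattice vector strictly between u and e in slope is as short as e, so the Farey neighbor edges of e are the unique pair of edges shorter than e whose slopes are closest to the slope of e from either side. -/
/-- `w` lies in the open cone `{s·u + t·e : s, t > 0}` spanned by `u` and `e`. -/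
def InOpenCone (u e w : ℤ × ℤ) : Prop :=
  ∃ s t : ℝ, 0 < s ∧ 0 < t ∧
    (w.1 : ℝ) = s * u.1 + t * e.1 ∧ (w.2 : ℝ) = s * u.2 + t * e.2

/-- The coordinates of an integer vector of the open cone over a lattice basis are positive
integers. -/
theorem InOpenCone.exists_int_coeffs {u e w : ℤ × ℤ} (hdet : |det2 u e| = 1)
    (hw : InOpenCone u e w) :
    ∃ m n : ℤ, 1 ≤ m ∧ 1 ≤ n ∧ w.1 = m * u.1 + n * e.1 ∧ w.2 = m * u.2 + n * e.2 := by
  obtain ⟨s, t, hs, ht, h1, h2⟩ := hw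
  have hd : det2 u e * det2 u e = 1 := by rw [← abs_mul_abs_self, hdet, one_mul]
  have hdR : (det2 u e : ℝ) * det2 u e = 1 := by exact_mod_cast hd
  have hm : ((det2 u e * det2 w e : ℤ) : ℝ) = s := by
    unfold det2 at hdR ⊢
    push_cast at hdR ⊢
    rw [h1, h2]
    linear_combination s * hdR
  have hn : ((det2 u e * det2 u w : ℤ) : ℝ) = t := by
    unfold det2 at hdR ⊢
    push_cast at hdR ⊢
    rw [h1, h2]
    linear_combination t * hdR
  refine ⟨det2 u e * det2 w e, det2 u e * det2 u w, ?_, ?_, ?_, ?_⟩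
  · rw [← hm] at hs
    exact_mod_cast hs
  · rw [← hn] at ht
    exact_mod_cast ht
  · unfold det2 at hd ⊢
    linear_combination -w.1 * hd
  · unfold det2 at hd ⊢
    linear_combination -w.2 * hd

/-- `Qval` is monotone on the nonnegative quadrant. -/
theorem Qval_le_Qval {p q : ℤ × ℤ} (hp1 : 0 ≤ p.1) (hp2 : 0 ≤ p.2) (h1 : p.1 ≤ q.1)
    (h2 : p.2 ≤ q.2) : Qval p ≤ Qval q := by
  have hq1 := hp1.trans h1
  unfold Qval
  gcongr

/-- Adding a nonzero nonnegative vector to a nonnegative vector increases `Qval`. -/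
theorem Qval_lt_Qval_add {u e : ℤ × ℤ} (hu1 : 0 ≤ u.1) (hu2 : 0 ≤ u.2) (he1 : 0 ≤ e.1)
    (he2 : 0 ≤ e.2) (hu : u ≠ 0) : Qval e < Qval (u + e) := by
  have hpos : 0 < u.1 ∨ 0 < u.2 := by
    by_contra! h
    exact hu (Prod.ext (le_antisymm h.1 hu1) (le_antisymm h.2 hu2))
  simp only [Qval, Prod.fst_add, Prod.snd_add]
  have := mul_nonneg hu1 hu2
  have := mul_nonneg hu1 he1
  have := mul_nonneg hu1 he2
  have := mul_nonneg hu2 he1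
  have := mul_nonneg hu2 he2
  rcases hpos with h | h
  · nlinarith [pow_pos h 2, sq_nonneg u.2]
  · nlinarith [pow_pos h 2, sq_nonneg u.1]

/-- If `|det(u,e)| = 1`, then every lattice point in the open cone spanned by
`u` and `e` has the form `m·u + n·e` with integers `m, n ≥ 1`; consequently,
if `u` and `e` have nonnegative coordinates, then `Q(w) ≥ Q(u+e) > Q(e)` for
every such lattice point `w`. -/
theorem stmt6 (u e : ℤ × ℤ) (hdet : |det2 u e| = 1) :
    (∀ w : ℤ × ℤ, InOpenCone u e w →
      ∃ m n : ℤ, 1 ≤ m ∧ 1 ≤ n ∧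
        w.1 = m * u.1 + n * e.1 ∧ w.2 = m * u.2 + n * e.2) ∧
    ((0 ≤ u.1 ∧ 0 ≤ u.2 ∧ 0 ≤ e.1 ∧ 0 ≤ e.2) →
      ∀ w : ℤ × ℤ, InOpenCone u e w →
        Qval (u + e) ≤ Qval w ∧ Qval e < Qval (u + e)) := by
  refine ⟨fun w hw => hw.exists_int_coeffs hdet, fun ⟨hu1, hu2, he1, he2⟩ w hw => ⟨?_, ?_⟩⟩
  · obtain ⟨m, n, hm, hn, h1, h2⟩ := hw.exists_int_coeffs hdet
    apply Qval_le_Qval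
    · exact add_nonneg hu1 he1
    · exact add_nonneg hu2 he2
    · rw [h1]
      exact add_le_add (le_mul_of_one_le_left hu1 hm) (le_mul_of_one_le_left he1 hn)
    · rw [h2]
      exact add_le_add (le_mul_of_one_le_left hu2 hm) (le_mul_of_one_le_left he2 hn)
  · refine Qval_lt_Qval_add hu1 hu2 he1 he2 ?_
    rintro rfl
    simp [det2] at hdet
end

section
/- Let u, v ∈ ℤ² be linearly independent. The closed parallelogram {s·u + t·v : s, t ∈ [0,1]} ⊆ ℝ² contains no lattice point of ℤ² other than its four vertices 0, u, v, u+v if and only if |det(u,v)| = 1. -/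
/-- If the parallelogram spanned by `u` and `v` contains only its vertices as lattice points, then
`u` and `v` generate `ℤ²`. -/
theorem ParNoLattice.exists_eq_add {u v : ℤ × ℤ} (hind : det2 u v ≠ 0) (h : ParNoLattice u v)
    (w : ℤ × ℤ) : ∃ a b : ℤ, w.1 = a * u.1 + b * v.1 ∧ w.2 = a * u.2 + b * v.2 := by
  have hD : (u.1 : ℝ) * v.2 - v.1 * u.2 ≠ 0 := by
    unfold det2 at hind
    exact_mod_cast hind
  set s : ℝ := (w.1 * v.2 - v.1 * w.2) / (u.1 * v.2 - v.1 * u.2) with hs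
  set t : ℝ := (u.1 * w.2 - w.1 * u.2) / (u.1 * v.2 - v.1 * u.2) with ht
  have h1 : (w.1 : ℝ) = s * u.1 + t * v.1 := by
    rw [hs, ht, div_mul_eq_mul_div, div_mul_eq_mul_div, ← add_div, eq_div_iff hD]
    ring
  have h2 : (w.2 : ℝ) = s * u.2 + t * v.2 := by
    rw [hs, ht, div_mul_eq_mul_div, div_mul_eq_mul_div, ← add_div, eq_div_iff hD]
    ring
  have key := h (w.1 - ⌊s⌋ * u.1 - ⌊t⌋ * v.1, w.2 - ⌊s⌋ * u.2 - ⌊t⌋ * v.2)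
    ⟨Int.fract s, Int.fract t, Int.fract_nonneg s, (Int.fract_lt_one s).le,
      Int.fract_nonneg t, (Int.fract_lt_one t).le, by
        push_cast
        rw [h1, Int.fract, Int.fract]
        ring, by
        push_cast
        rw [h2, Int.fract, Int.fract]
        ring⟩
  simp only [Prod.ext_iff, Prod.fst_add, Prod.snd_add, Prod.fst_zero, Prod.snd_zero] at key
  rcases key with ⟨k1, k2⟩ | ⟨k1, k2⟩ | ⟨k1, k2⟩ | ⟨k1, k2⟩
  · exact ⟨⌊s⌋, ⌊t⌋, by linarith, by linarith⟩
  · exact ⟨⌊s⌋ + 1, ⌊t⌋, by linarith, by linarith⟩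
  · exact ⟨⌊s⌋, ⌊t⌋ + 1, by linarith, by linarith⟩
  · exact ⟨⌊s⌋ + 1, ⌊t⌋ + 1, by linarith, by linarith⟩

/-- A real number in `[0, 1]` whose product with an integer of absolute value one is an integer
is `0` or `1`. -/
theorem eq_zero_or_eq_one_of_mul_eq_intCast {d n : ℤ} {s : ℝ} (hd : |d| = 1) (h0 : 0 ≤ s)
    (h1 : s ≤ 1) (h : s * d = n) : s = 0 ∨ s = 1 := by
  have hdd : d * d = 1 := by rw [← abs_mul_abs_self, hd, one_mul]
  have hs : s = ((n * d : ℤ) : ℝ) := by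
    have hdd' : (d : ℝ) * d = 1 := by exact_mod_cast hdd
    push_cast
    rw [← h, mul_assoc, hdd', mul_one]
  rw [hs] at h0 h1 ⊢
  norm_cast at h0 h1 ⊢
  omega

/-- For linearly independent `u, v ∈ ℤ²`, the closed parallelogram spanned by
`u` and `v` contains no lattice point other than its four vertices iff
`|det(u,v)| = 1`. -/
theorem stmt9 (u v : ℤ × ℤ) (hind : det2 u v ≠ 0) :
    ParNoLattice u v ↔ |det2 u v| = 1 := by
  constructor
  · intro h
    obtain ⟨a, b, h1, h2⟩ := h.exists_eq_add hind (1, 0)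
    obtain ⟨c, d, h3, h4⟩ := h.exists_eq_add hind (0, 1)
    simp only at h1 h2 h3 h4
    refine Int.isUnit_iff_abs_eq.mp (IsUnit.of_mul_eq_one (a * d - b * c) ?_)
    unfold det2
    calc (u.1 * v.2 - v.1 * u.2) * (a * d - b * c)
        = (a * u.1 + b * v.1) * (c * u.2 + d * v.2)
          - (a * u.2 + b * v.2) * (c * u.1 + d * v.1) := by ring
      _ = 1 := by rw [← h1, ← h2, ← h3, ← h4]; norm_num
  · rintro h w ⟨s, t, hs0, hs1, ht0, ht1, h1, h2⟩
    have hs : s = 0 ∨ s = 1 := by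
      refine eq_zero_or_eq_one_of_mul_eq_intCast (n := det2 w v) h hs0 hs1 ?_
      simp only [det2]
      push_cast
      rw [h1, h2]
      ring
    have ht : t = 0 ∨ t = 1 := by
      refine eq_zero_or_eq_one_of_mul_eq_intCast (n := det2 u w) h ht0 ht1 ?_
      simp only [det2]
      push_cast
      rw [h1, h2]
      ring
    simp only [Prod.ext_iff, Prod.fst_add, Prod.snd_add, Prod.fst_zero, Prod.snd_zero]
    rcases hs with rfl | rfl <;> rcases ht with rfl | rfl <;>
      simp only [zero_mul, one_mul, zero_add, add_zero] at h1 h2 <;> norm_cast at h1 h2 <;>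
      simp [h1, h2]
end
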